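/- arXiv:2107.09191 — 2 statements merged into one kernel-verified Lean document; each statement's English description precedes it below -/
import Mathlib

section
/- Let q be an odd prime power, F the finite field with q² elements, ζ ∈ F with ζ^{q+1} = −1, and A = [[1, ζ],[0, 0]]. Then the numerical range is the complement of the vertical line x = 1/2: W(A) = { x + β·y : x, y ∈ 𝔽_q, x ≠ 2⁻¹ }. Moreover, for every z = x + β·y with x ≠ 2⁻¹ we have |S_z| = q + 1, and for every z = 2⁻¹ + β·y the set S_z is empty. -/
open Matrix MvPolynomial

noncomputable section

/-- Conjugate transpose with respect to the Frobenius `x ↦ x ^ q`. -/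
def ctrans {F : Type*} [Field F] (q : ℕ) {n : ℕ}
    (A : Matrix (Fin n) (Fin n) F) : Matrix (Fin n) (Fin n) F :=
  Matrix.of fun i j => (A j i) ^ q

/-- The Hermitian form `⟨u, v⟩ = v* u`. -/
def herm {F : Type*} [Field F] (q : ℕ) {n : ℕ} (u v : Fin n → F) : F :=
  ∑ i, (v i) ^ q * u i

/-- The finite-field numerical range `W(A)`. -/
def numRange {F : Type*} [Field F] (q : ℕ) {n : ℕ}
    (A : Matrix (Fin n) (Fin n) F) : Set F :=
  {z | ∃ v : Fin n → F, herm q v v = 1 ∧ herm q (A.mulVec v) v = z}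

/-- `H₁ = (A + A*) / 2`, the Hermitian part of `A`. -/
def Hone {F : Type*} [Field F] (q : ℕ) {n : ℕ}
    (A : Matrix (Fin n) (Fin n) F) : Matrix (Fin n) (Fin n) F :=
  (2 : F)⁻¹ • (A + ctrans q A)

/-- `H₂ = (A - A*) / (2 β)`. -/
def Htwo {F : Type*} [Field F] (q : ℕ) (β : F) {n : ℕ}
    (A : Matrix (Fin n) (Fin n) F) : Matrix (Fin n) (Fin n) F :=
  (2 * β)⁻¹ • (A - ctrans q A)

/-- The base polynomial `F_A(x, y, t) = det (x H₁ + y H₂ + t I)`,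
as a polynomial in the three variables `X 0 = x`, `X 1 = y`, `X 2 = t`. -/
def basePoly {F : Type*} [Field F] (q : ℕ) (β : F) {n : ℕ} [DecidableEq (Fin n)]
    (A : Matrix (Fin n) (Fin n) F) : MvPolynomial (Fin 3) F :=
  Matrix.det (Matrix.of fun i j =>
    X 0 * C (Hone q A i j) + X 1 * C (Htwo q β A i j) +
      X 2 * C ((1 : Matrix (Fin n) (Fin n) F) i j))

/-- The gradient `∇F_A = (∂F_A/∂x, ∂F_A/∂y, ∂F_A/∂t)` evaluated at a point `p ∈ F³`. -/
def gradBP {F : Type*} [Field F] (q : ℕ) (β : F) {n : ℕ} [DecidableEq (Fin n)]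
    (A : Matrix (Fin n) (Fin n) F) (p : Fin 3 → F) : Fin 3 → F :=
  fun i => eval p (pderiv i (basePoly q β A))

/-- `F_A` is nonsingular at a point `p`. -/
def NonsingAt {F : Type*} [Field F] (q : ℕ) (β : F) {n : ℕ} [DecidableEq (Fin n)]
    (A : Matrix (Fin n) (Fin n) F) (p : Fin 3 → F) : Prop :=
  ¬ (eval p (basePoly q β A) = 0 ∧ gradBP q β A p = 0)

/-- `F_A` is nonsingular (at every nonzero point of `F³`). -/
def Nonsing {F : Type*} [Field F] (q : ℕ) (β : F) {n : ℕ} [DecidableEq (Fin n)]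
    (A : Matrix (Fin n) (Fin n) F) : Prop :=
  ∀ p : Fin 3 → F, p ≠ 0 → NonsingAt q β A p

/-- The (affine) boundary generating curve `Γ_A^∧`:  points `x₀ + β y₀` with
`x₀, y₀ ∈ 𝔽_q` such that the line `x₀ x + y₀ y + t = 0` is tangent to the base curve,
i.e. `∇F_A(p) = c • (x₀, y₀, 1)` for some point `p` of the base curve and `c ≠ 0`. -/
def bgCurve {F : Type*} [Field F] (q : ℕ) (β : F) {n : ℕ} [DecidableEq (Fin n)]
    (A : Matrix (Fin n) (Fin n) F) : Set F :=
  {z | ∃ x₀ y₀ : F, x₀ ^ q = x₀ ∧ y₀ ^ q = y₀ ∧ z = x₀ + β * y₀ ∧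
    ∃ p : Fin 3 → F, p ≠ 0 ∧ ∃ c : F, c ≠ 0 ∧
      eval p (basePoly q β A) = 0 ∧ gradBP q β A p = c • ![x₀, y₀, (1 : F)]}

/-- The preimage `S_z` of `z` under the numerical range map. -/
def preim {F : Type*} [Field F] (q : ℕ) {n : ℕ}
    (A : Matrix (Fin n) (Fin n) F) (z : F) : Set (Fin n → F) :=
  {v | herm q v v = 1 ∧ herm q (A.mulVec v) v = z}

end

/-- Over a field with `q ^ 2` elements, the fibre of `a ↦ a ^ (q + 1)` over a nonzero element
fixed by `x ↦ x ^ q` has `q + 1` points. -/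
theorem ncard_norm_fiber {F : Type*} [Field F] [Fintype F] {q : ℕ} (hq : 1 < q)
    (hcard : Fintype.card F = q ^ 2) {c : F} (hc0 : c ≠ 0) (hc : c ^ q = c) :
    {a : F | a ^ (q + 1) = c}.ncard = q + 1 := by
  classical
  obtain ⟨r, rfl⟩ : ∃ r, q = r + 1 := ⟨q - 1, by omega⟩
  have hr : 0 < r := by omega
  have hsub : Nat.card Fˣ = r * (r + 1 + 1) := by
    rw [Nat.card_eq_fintype_card, Fintype.card_units, hcard,
      show (r + 1) ^ 2 = r * (r + 1 + 1) + 1 by ring, Nat.add_sub_cancel]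
  obtain ⟨g, hg⟩ := IsCyclic.exists_generator (α := Fˣ)
  have hord : orderOf g = r * (r + 1 + 1) := by
    rw [orderOf_eq_card_of_forall_mem_zpowers hg, hsub]
  have hprim : IsPrimitiveRoot ((g : F) ^ r) (r + 1 + 1) := by
    have h : IsPrimitiveRoot (g : F) (r * (r + 1 + 1)) := by
      rw [← hord, ← orderOf_units]
      exact IsPrimitiveRoot.orderOf _
    exact h.pow (by positivity) rfl
  have hroot : ∃ d : F, d ^ (r + 1 + 1) = c := by
    obtain ⟨m, hm⟩ := (mem_powers_iff_mem_zpowers (x := g) (y := Units.mk0 c hc0)).2 (hg _)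
    have hm' : g ^ m = Units.mk0 c hc0 := hm
    have h1 : g ^ (m * r) = 1 := by
      rw [pow_mul, hm']
      ext
      simp only [Units.val_pow_eq_pow_val, Units.val_mk0, Units.val_one]
      exact mul_right_cancel₀ hc0 (by rw [← pow_succ, hc, one_mul])
    have h2 : r * (r + 1 + 1) ∣ r * m := by
      rw [← hord, mul_comm r m]
      exact orderOf_dvd_of_pow_eq_one h1
    obtain ⟨j, rfl⟩ := Nat.dvd_of_mul_dvd_mul_left hr h2
    refine ⟨((g ^ j : Fˣ) : F), ?_⟩
    rw [← Units.val_pow_eq_pow_val, ← pow_mul, mul_comm j, hm', Units.val_mk0]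
  have hset : {a : F | a ^ (r + 1 + 1) = c} =
      ((Polynomial.nthRoots (r + 1 + 1) c).toFinset : Set F) := by
    ext a
    simp [Polynomial.mem_nthRoots]
  rw [hset, Set.ncard_coe_finset,
    Multiset.toFinset_card_of_nodup (hprim.nthRoots_nodup hc0), hprim.card_nthRoots, if_pos hroot]

theorem mem_preim_iff {F : Type*} [Field F] {q : ℕ} {ζ z : F} {v : Fin 2 → F} :
    v ∈ preim q !![1, ζ; 0, 0] z ↔
      v 0 ^ q * v 0 + v 1 ^ q * v 1 = 1 ∧ v 0 ^ q * (v 0 + ζ * v 1) = z := by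
  simp [preim, herm, Matrix.mulVec, dotProduct, Fin.sum_univ_two]

section Conjugation

variable {F : Type*} [Field F] {q : ℕ} {ζ : F}

/-- Taking norms in `⟨Av, v⟩ = z` determines `|v₀|²` from `z`. -/
theorem norm_eq_of_mem_preim (hadd : ∀ a b : F, (a + b) ^ q = a ^ q + b ^ q)
    (hinv : ∀ a : F, (a ^ q) ^ q = a) (hζ : ζ ^ (q + 1) = -1) {z : F} {v : Fin 2 → F}
    (hv : v ∈ preim q !![1, ζ; 0, 0] z) :
    z * z ^ q = v 0 ^ q * v 0 * (z + z ^ q - 1) := by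
  obtain ⟨h1, rfl⟩ := mem_preim_iff.1 hv
  simp only [mul_pow, hadd, hinv]
  rw [pow_succ] at hζ
  linear_combination (-(v 0 ^ q * v 0)) * h1 + v 0 ^ q * v 0 * v 1 ^ q * v 1 * hζ

theorem preim_eq_empty (hadd : ∀ a b : F, (a + b) ^ q = a ^ q + b ^ q)
    (hinv : ∀ a : F, (a ^ q) ^ q = a) (hq : q ≠ 0) (hζ : ζ ^ (q + 1) = -1) {z : F}
    (hz : z + z ^ q = 1) : preim q !![1, ζ; 0, 0] z = ∅ := by
  refine Set.eq_empty_of_forall_notMem fun v hv => ?_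
  have h := norm_eq_of_mem_preim hadd hinv hζ hv
  rw [hz, sub_self, mul_zero, ← pow_succ'] at h
  simp [eq_zero_of_pow_eq_zero h, hq] at hz

theorem ncard_preim [Fintype F] (hadd : ∀ a b : F, (a + b) ^ q = a ^ q + b ^ q)
    (hcard : Fintype.card F = q ^ 2) (hq : 1 < q) (hζ : ζ ^ (q + 1) = -1) {z : F}
    (hz : z + z ^ q ≠ 1) : (preim q !![1, ζ; 0, 0] z).ncard = q + 1 := by
  have hq0 : q ≠ 0 := by omega
  have hinv (a : F) : (a ^ q) ^ q = a := by
    rw [← pow_mul, ← sq, ← hcard, FiniteField.pow_card]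
  have hsub (a b : F) : (a - b) ^ q = a ^ q - b ^ q :=
    eq_sub_of_add_eq (by rw [← hadd, sub_add_cancel])
  have hζ0 : ζ ≠ 0 := by
    rintro rfl
    simp at hζ
  rcases eq_or_ne z 0 with rfl | hz0
  · rw [← ncard_norm_fiber hq hcard one_ne_zero (one_pow q),
      ← Set.ncard_image_of_injective (f := fun b : F => ![0, b]) _
        fun b b' h => by simpa using congrFun h 1]
    congr 1
    ext v
    constructor
    · intro hv
      have h := norm_eq_of_mem_preim hadd hinv hζ hv
      have h0 : v 0 = 0 := by simpa [hq0] using h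
      obtain ⟨h1, -⟩ := mem_preim_iff.1 hv
      refine ⟨v 1, by simpa [h0, hq0, pow_succ] using h1, ?_⟩
      ext i
      fin_cases i <;> simp [h0]
    · rintro ⟨b, hb, rfl⟩
      rw [mem_preim_iff]
      simpa [hq0, pow_succ] using hb
  · have hd : z + z ^ q - 1 ≠ 0 := sub_ne_zero.2 hz
    set c : F := z * z ^ q / (z + z ^ q - 1) with hcdef
    have hc0 : c ≠ 0 := div_ne_zero (mul_ne_zero hz0 (pow_ne_zero _ hz0)) hd
    have hc : c ^ q = c := by
      rw [hcdef, div_pow, mul_pow, hsub, hadd, hinv, one_pow, mul_comm (z ^ q), add_comm (z ^ q)]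
    have hcz : c * (z + z ^ q - 1) = z * z ^ q := div_mul_cancel₀ _ hd
    rw [← ncard_norm_fiber hq hcard hc0 hc,
      ← Set.ncard_image_of_injective (f := fun a : F => ![a, (z - c) / (ζ * a ^ q)]) _
        fun a a' h => by simpa using congrFun h 0]
    congr 1
    ext v
    constructor
    · intro hv
      have h0 : v 0 ^ q * v 0 = c :=
        mul_right_cancel₀ hd (by rw [hcz, norm_eq_of_mem_preim hadd hinv hζ hv])
      have hv0 : v 0 ^ q ≠ 0 := left_ne_zero_of_mul (h0 ▸ hc0)
      obtain ⟨-, h2⟩ := mem_preim_iff.1 hv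
      have h1 : (z - c) / (ζ * v 0 ^ q) = v 1 := by
        rw [div_eq_iff (mul_ne_zero hζ0 hv0)]
        linear_combination h0 - h2
      refine ⟨v 0, (pow_succ _ _).trans h0, ?_⟩
      ext i
      fin_cases i <;> simp [h1]
    · rintro ⟨a, ha, rfl⟩
      have ha' : a ^ q * a = c := (pow_succ a q).symm.trans ha
      have ha0 : a ≠ 0 := right_ne_zero_of_mul (ha' ▸ hc0)
      have haq : a ^ q ≠ 0 := pow_ne_zero _ ha0
      rw [mem_preim_iff]
      simp only [Matrix.cons_val_zero, Matrix.cons_val_one]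
      constructor
      · rw [div_pow, mul_pow, hinv, hsub, hc, div_mul_div_comm,
          show ζ ^ q * a * (ζ * a ^ q) = -c by
            linear_combination a * a ^ q * hζ - ha', ha']
        field_simp
        linear_combination hcz
      · field_simp
        linear_combination ha'

end Conjugation

theorem stmt_17 {F : Type*} [Field F] [Fintype F] (q : ℕ)
    (hq : ∃ p k : ℕ, p.Prime ∧ Odd p ∧ 0 < k ∧ q = p ^ k)
    (hcard : Fintype.card F = q ^ 2)
    (β : F) (hβ0 : β ≠ 0) (hβ : β ^ q = -β)
    (ζ : F) (hζ : ζ ^ (q + 1) = -1) :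
    numRange q (!![1, ζ; 0, 0]) =
      {z : F | ∃ x y : F, x ^ q = x ∧ y ^ q = y ∧ z = x + β * y ∧ x ≠ 2⁻¹} ∧
    (∀ x y : F, x ^ q = x → y ^ q = y → x ≠ 2⁻¹ →
      (preim q (!![1, ζ; 0, 0]) (x + β * y)).ncard = q + 1) ∧
    (∀ y : F, y ^ q = y → preim q (!![1, ζ; 0, 0]) (2⁻¹ + β * y) = ∅) := by
  obtain ⟨p, k, hp, hodd, hk, rfl⟩ := hq
  set q := p ^ k with hqdef
  have hq : 1 < q := Nat.one_lt_pow hk.ne' hp.one_lt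
  have := Fact.mk hp
  have : CharP F p := charP_of_card_eq_prime_pow (f := k * 2) (by rw [hcard, hqdef, pow_mul])
  have hadd (a b : F) : (a + b) ^ q = a ^ q + b ^ q := add_pow_char_pow a b p k
  have hinv (a : F) : (a ^ q) ^ q = a := by
    rw [← pow_mul, ← sq, ← hcard, FiniteField.pow_card]
  have hsub (a b : F) : (a - b) ^ q = a ^ q - b ^ q :=
    eq_sub_of_add_eq (by rw [← hadd, sub_add_cancel])
  have h2 : (2 : F) ≠ 0 := Ring.two_ne_zero (by
    rw [ringChar.eq F p]
    rintro rfl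
    exact absurd hodd (by decide))
  have h2q : (2 : F) ^ q = 2 := by rw [← one_add_one_eq_two, hadd, one_pow]
  have htrace {x y : F} (hx : x ^ q = x) (hy : y ^ q = y) :
      (x + β * y) + (x + β * y) ^ q = 2 * x := by
    rw [hadd, mul_pow, hx, hy, hβ]
    ring
  have hne {x : F} (hx : x ≠ 2⁻¹) : 2 * x ≠ 1 := fun h => hx (eq_inv_of_mul_eq_one_right h)
  have hcount (x y : F) (hx : x ^ q = x) (hy : y ^ q = y) (hx2 : x ≠ 2⁻¹) :
      (preim q (!![1, ζ; 0, 0]) (x + β * y)).ncard = q + 1 :=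
    ncard_preim hadd hcard hq hζ (by rw [htrace hx hy]; exact hne hx2)
  have hempty (y : F) (hy : y ^ q = y) :
      preim q (!![1, ζ; 0, 0]) (2⁻¹ + β * y) = ∅ :=
    preim_eq_empty hadd hinv (by omega) hζ (by
      rw [htrace (by rw [inv_pow, h2q]) hy, mul_inv_cancel₀ h2])
  refine ⟨?_, hcount, hempty⟩
  ext z
  constructor
  · rintro ⟨v, hv⟩
    have hx : ((z + z ^ q) / 2) ^ q = (z + z ^ q) / 2 := by
      rw [div_pow, hadd, hinv, h2q, add_comm]
    have hy : ((z - z ^ q) / (2 * β)) ^ q = (z - z ^ q) / (2 * β) := by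
      rw [div_pow, mul_pow, hsub, hinv, h2q, hβ, mul_neg, div_neg, ← neg_div, neg_sub]
    have hz : z = (z + z ^ q) / 2 + β * ((z - z ^ q) / (2 * β)) := by
      field_simp
      ring
    refine ⟨_, _, hx, hy, hz, fun h => ?_⟩
    have hmem : v ∈ preim q !![1, ζ; 0, 0] z := hv
    rw [hz, h, hempty _ hy] at hmem
    exact hmem
  · rintro ⟨x, y, hx, hy, rfl, hx2⟩
    have hn : (preim q !![1, ζ; 0, 0] (x + β * y)).Nonempty :=
      Set.nonempty_of_ncard_ne_zero (by rw [hcount x y hx hy hx2]; omega)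
    exact hn
end

section
/- Let q be an odd prime power, F the finite field with q² elements, and A = [[1, 0],[0, 0]]. Then W(A) equals the subfield 𝔽_q = {x ∈ F : x^q = x}, and the preimage cardinalities under the numerical range map are: |S_0| = |S_1| = q + 1, while for every z ∈ 𝔽_q with z ≠ 0 and z ≠ 1, |S_z| = (q + 1)². -/
open Matrix MvPolynomial

/-- In a finite field with `q ^ 2` elements there is a primitive `(q ^ 2 - 1)`-th root of unity. -/
theorem exists_isPrimitiveRoot_of_card_eq_sq {F : Type*} [Field F] [Fintype F] {q : ℕ}
    (hcard : Fintype.card F = q ^ 2) :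
    ∃ g : F, IsPrimitiveRoot g ((q + 1) * (q - 1)) := by
  obtain ⟨g, hg⟩ := IsCyclic.exists_generator (α := Fˣ)
  have ho : orderOf g = (q + 1) * (q - 1) := by
    rw [orderOf_eq_card_of_forall_mem_zpowers hg, Nat.card_units, Nat.card_eq_fintype_card, hcard]
    simpa using Nat.sq_sub_sq q 1
  exact ⟨g, IsPrimitiveRoot.coe_units_iff.2 (ho ▸ IsPrimitiveRoot.orderOf g)⟩

/-- A norm `x ^ (q + 1)` from the field with `q ^ 2` elements lies in the field with `q`
elements. -/
theorem pow_succ_pow_eq_of_card_eq_sq {F : Type*} [Field F] [Fintype F] {q : ℕ}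
    (hcard : Fintype.card F = q ^ 2) (x : F) : (x ^ (q + 1)) ^ q = x ^ (q + 1) := by
  have h : x ^ (q ^ 2) = x := hcard ▸ FiniteField.pow_card x
  calc (x ^ (q + 1)) ^ q = x ^ (q ^ 2) * x ^ q := by ring
    _ = x ^ (q + 1) := by rw [h]; ring

/-- The fibre of the norm `x ↦ x ^ (q + 1)` over a nonzero element of the subfield with `q`
elements has `q + 1` elements. -/
theorem ncard_pow_succ_eq_of_card_eq_sq {F : Type*} [Field F] [Fintype F] {q : ℕ} (hq : 1 < q)
    (hcard : Fintype.card F = q ^ 2) {z : F} (hz : z ^ q = z) (hz0 : z ≠ 0) :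
    {x : F | x ^ (q + 1) = z}.ncard = q + 1 := by
  classical
  obtain ⟨g, hg⟩ := exists_isPrimitiveRoot_of_card_eq_sq hcard
  have hpos : 0 < (q + 1) * (q - 1) := Nat.mul_pos (by omega) (by omega)
  have : NeZero (q - 1) := ⟨by omega⟩
  have hz1 : z ^ (q - 1) = 1 := by
    apply mul_right_cancel₀ hz0
    rw [← pow_succ, Nat.sub_add_cancel hq.le, hz, one_mul]
  obtain ⟨i, -, hi⟩ := (hg.pow hpos rfl).eq_pow_of_pow_eq_one hz1
  have hroot : (g ^ i) ^ (q + 1) = z := by rw [← hi, ← pow_mul, ← pow_mul, mul_comm]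
  have hprim : IsPrimitiveRoot (g ^ (q - 1)) (q + 1) := hg.pow hpos (mul_comm _ _)
  have hset : {x : F | x ^ (q + 1) = z} = ((Polynomial.nthRoots (q + 1) z).toFinset : Set F) := by
    ext x
    simp [Polynomial.mem_nthRoots (Nat.succ_pos q)]
  rw [hset, Set.ncard_coe_finset, Multiset.toFinset_card_of_nodup (hprim.nthRoots_nodup hz0),
    hprim.card_nthRoots, if_pos ⟨_, hroot⟩]

/-- The fibre of the norm `x ↦ x ^ (q + 1)` over zero is a single point. -/
theorem ncard_pow_succ_eq_zero {F : Type*} [Field F] (q : ℕ) :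
    {x : F | x ^ (q + 1) = 0}.ncard = 1 := by
  simp

theorem mem_preim_diag_one_zero {F : Type*} [Field F] {q : ℕ} {z : F} {v : Fin 2 → F} :
    v ∈ preim q !![(1 : F), 0; 0, 0] z ↔ v 0 ^ (q + 1) = z ∧ v 1 ^ (q + 1) = 1 - z := by
  simp only [preim, herm, Set.mem_ofPred_eq, Fin.sum_univ_two, ← pow_succ, Matrix.mulVec,
    dotProduct, Matrix.of_apply, Matrix.cons_val_zero, Matrix.cons_val_one, one_mul, zero_mul,
    add_zero, mul_zero]
  constructor
  · rintro ⟨h, rfl⟩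
    exact ⟨rfl, eq_sub_of_add_eq' h⟩
  · rintro ⟨h, h'⟩
    exact ⟨by rw [h, h']; ring, h⟩

/-- The fibres of the numerical range map of `diag(1, 0)` are products of fibres of the norm. -/
theorem ncard_preim_diag_one_zero {F : Type*} [Field F] (q : ℕ) (z : F) :
    (preim q !![(1 : F), 0; 0, 0] z).ncard =
      {x : F | x ^ (q + 1) = z}.ncard * {x : F | x ^ (q + 1) = 1 - z}.ncard := by
  rw [← Set.ncard_prod, ← Set.ncard_image_of_injective _ (finTwoArrowEquiv F).injective]
  congr 1
  ext ⟨a, b⟩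
  rw [Equiv.image_eq_preimage_symm, Set.mem_preimage, mem_preim_diag_one_zero]
  simp

theorem stmt_18 {F : Type*} [Field F] [Fintype F] (q : ℕ)
    (hq : ∃ p k : ℕ, p.Prime ∧ Odd p ∧ 0 < k ∧ q = p ^ k)
    (hcard : Fintype.card F = q ^ 2)
    (β : F) (hβ0 : β ≠ 0) (hβ : β ^ q = -β) :
    numRange q (!![(1 : F), 0; 0, 0]) = {x : F | x ^ q = x} ∧
    (preim q (!![(1 : F), 0; 0, 0]) 0).ncard = q + 1 ∧
    (preim q (!![(1 : F), 0; 0, 0]) 1).ncard = q + 1 ∧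
    ∀ z : F, z ^ q = z → z ≠ 0 → z ≠ 1 →
      (preim q (!![(1 : F), 0; 0, 0]) z).ncard = (q + 1) ^ 2 := by
  obtain ⟨p, k, hp, -, hk, rfl⟩ := hq
  have : Fact p.Prime := ⟨hp⟩
  have : CharP F p := charP_of_card_eq_prime_pow (f := k * 2) (by rw [hcard, pow_mul])
  have hq1 : 1 < p ^ k := Nat.one_lt_pow hk.ne' hp.one_lt
  have hsub {z : F} (hz : z ^ p ^ k = z) : (1 - z) ^ p ^ k = 1 - z := by
    rw [sub_pow_char_pow, one_pow, hz]
  have hone : {x : F | x ^ (p ^ k + 1) = 1}.ncard = p ^ k + 1 :=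
    ncard_pow_succ_eq_of_card_eq_sq hq1 hcard (one_pow _) one_ne_zero
  have h0 : (preim (p ^ k) !![(1 : F), 0; 0, 0] 0).ncard = p ^ k + 1 := by
    rw [ncard_preim_diag_one_zero, sub_zero, ncard_pow_succ_eq_zero, hone, one_mul]
  have h1 : (preim (p ^ k) !![(1 : F), 0; 0, 0] 1).ncard = p ^ k + 1 := by
    rw [ncard_preim_diag_one_zero, sub_self, ncard_pow_succ_eq_zero, hone, mul_one]
  have h2 (z : F) (hz : z ^ p ^ k = z) (hz0 : z ≠ 0) (hz1 : z ≠ 1) :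
      (preim (p ^ k) !![(1 : F), 0; 0, 0] z).ncard = (p ^ k + 1) ^ 2 := by
    rw [ncard_preim_diag_one_zero, ncard_pow_succ_eq_of_card_eq_sq hq1 hcard hz hz0,
      ncard_pow_succ_eq_of_card_eq_sq hq1 hcard (hsub hz) (sub_ne_zero.2 hz1.symm), sq]
  refine ⟨Set.Subset.antisymm ?_ ?_, h0, h1, h2⟩
  · rintro z ⟨v, hv⟩
    rw [Set.mem_ofPred_eq, ← (mem_preim_diag_one_zero.1 hv).1]
    exact pow_succ_pow_eq_of_card_eq_sq hcard _
  · intro z hz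
    refine Set.nonempty_of_ncard_ne_zero (s := preim (p ^ k) !![(1 : F), 0; 0, 0] z) ?_
    by_cases hz0 : z = 0
    · rw [hz0, h0]
      exact Nat.succ_ne_zero _
    by_cases hz1 : z = 1
    · rw [hz1, h1]
      exact Nat.succ_ne_zero _
    rw [h2 z hz hz0 hz1]
    exact pow_ne_zero _ (Nat.succ_ne_zero _)
end
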